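/- Let X ∈ M_{2N}(ℂ) be a self-dual matrix. Then there exist a symplectic unitary matrix U ∈ M_{2N}(ℂ) and matrices A, C ∈ M_N(ℂ) such that U† X U is the block matrix [[A, C],[0, Aᵀ]], where A is upper Hessenberg (A_{ij} = 0 whenever i > j+1) and every subdiagonal entry A_{j+1,j} of A is a real number. -/

import Mathlib

open Matrix
open scoped Kronecker ComplexOrder

/-- The 2N×2N matrix `Z = [[0, -I],[I, 0]]`. -/
noncomputable def Zmat (N : ℕ) : Matrix (Fin N ⊕ Fin N) (Fin N ⊕ Fin N) ℂ :=
  Matrix.fromBlocks 0 (-1) 1 0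

/-- The dual `X♯ = -Z Xᵀ Z` of a 2N×2N complex matrix. -/
noncomputable def dual {N : ℕ} (X : Matrix (Fin N ⊕ Fin N) (Fin N ⊕ Fin N) ℂ) :
    Matrix (Fin N ⊕ Fin N) (Fin N ⊕ Fin N) ℂ :=
  -(Zmat N) * Xᵀ * (Zmat N)

lemma pvl_skew {ι : Type*} [Fintype ι] (M : Matrix ι ι ℂ) (hM : Mᵀ = -M) (u w : ι → ℂ) :
    u ⬝ᵥ M *ᵥ w = -(w ⬝ᵥ M *ᵥ u) := by
  rw [dotProduct_mulVec, ← mulVec_transpose, hM, neg_mulVec, neg_dotProduct, dotProduct_comm]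

lemma pvl_alt {ι : Type*} [Fintype ι] (M : Matrix ι ι ℂ) (hM : Mᵀ = -M) (u : ι → ℂ) :
    u ⬝ᵥ M *ᵥ u = 0 := by
  have h := pvl_skew M hM u u
  exact self_eq_neg.mp h

lemma pvl_Zt (N : ℕ) : (Zmat N)ᵀ = -Zmat N := by
  simp [Zmat, fromBlocks_transpose, fromBlocks_neg]

lemma pvl_Zh (N : ℕ) : (Zmat N)ᴴ = -Zmat N := by
  simp [Zmat, fromBlocks_conjTranspose, fromBlocks_neg]

lemma pvl_ZZ (N : ℕ) : Zmat N * Zmat N = -1 := by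
  rw [← fromBlocks_one, fromBlocks_neg]
  simp [Zmat, fromBlocks_multiply]

lemma pvl_ZX {N : ℕ} (X : Matrix (Fin N ⊕ Fin N) (Fin N ⊕ Fin N) ℂ)
    (hX : dual X = X) : Zmat N * X = Xᵀ * Zmat N := by
  conv_lhs => rw [← hX]
  rw [dual, ← Matrix.mul_assoc, ← Matrix.mul_assoc, Matrix.mul_neg, pvl_ZZ]
  simp

lemma pvl_ZXt {N : ℕ} (X : Matrix (Fin N ⊕ Fin N) (Fin N ⊕ Fin N) ℂ)
    (hX : dual X = X) : (Zmat N * X)ᵀ = -(Zmat N * X) := by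
  rw [transpose_mul, pvl_Zt, Matrix.mul_neg, pvl_ZX X hX]

lemma pvl_normalize {ι : Type*} [Fintype ι] (w : ι → ℂ) (hw : w ≠ 0) :
    ∃ (r : ℝ) (s : ℂ) (u : ι → ℂ), star u ⬝ᵥ u = 1 ∧ w = (r : ℂ) • u ∧ u = s • w := by
  have hpos : 0 < star w ⬝ᵥ w := dotProduct_star_self_pos_iff.mpr hw
  obtain ⟨hre, him⟩ := Complex.pos_iff.mp hpos
  set t : ℝ := (star w ⬝ᵥ w).re with ht
  have hwt : star w ⬝ᵥ w = (t : ℂ) := Complex.ext rfl (by simp [← him])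
  have hr : Real.sqrt t ≠ 0 := (Real.sqrt_pos.mpr hre).ne'
  have hrc : (Real.sqrt t : ℂ) ≠ 0 := by exact_mod_cast hr
  refine ⟨Real.sqrt t, ((Real.sqrt t)⁻¹ : ℝ), (((Real.sqrt t)⁻¹ : ℝ) : ℂ) • w, ?_, ?_, rfl⟩
  · rw [star_smul, smul_dotProduct, dotProduct_smul, hwt]
    simp only [smul_eq_mul, Complex.star_def, Complex.conj_ofReal]
    norm_cast
    have := Real.mul_self_sqrt hre.le
    field_simp
    nlinarith
  · rw [smul_smul]
    push_cast
    rw [mul_inv_cancel₀ hrc, one_smul]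

lemma pvl_exists {N k : ℕ} (hk : k < N) (v : ℕ → (Fin N ⊕ Fin N) → ℂ) :
    ∃ u : (Fin N ⊕ Fin N) → ℂ, u ≠ 0 ∧ (∀ i < k, star (v i) ⬝ᵥ u = 0) ∧
      ∀ i < k, v i ⬝ᵥ Zmat N *ᵥ u = 0 := by
  let M : Matrix (Fin k ⊕ Fin k) (Fin N ⊕ Fin N) ℂ :=
    fromRows (Matrix.of fun i => star (v i)) (Matrix.of (fun i : Fin k => v i) * Zmat N)
  have hlt : Module.finrank ℂ ((Fin k ⊕ Fin k) → ℂ) < Module.finrank ℂ ((Fin N ⊕ Fin N) → ℂ) := by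
    simp; omega
  have hker := LinearMap.ker_ne_bot_of_finrank_lt (f := M.mulVecLin) hlt
  obtain ⟨u, hu, hu0⟩ := (Submodule.ne_bot_iff _).mp hker
  have hu' : M *ᵥ u = 0 := by simpa using hu
  rw [fromRows_mulVec] at hu'
  refine ⟨u, hu0, fun i hi => ?_, fun i hi => ?_⟩
  · exact congrFun hu' (Sum.inl ⟨i, hi⟩)
  · have := congrFun hu' (Sum.inr ⟨i, hi⟩)
    rw [Sum.elim_inr, ← mulVec_mulVec] at this
    exact this

/-- The partial Krylov-type basis of length `k`. -/
def PvlBasis {N : ℕ} (X : Matrix (Fin N ⊕ Fin N) (Fin N ⊕ Fin N) ℂ) (k : ℕ)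
    (v : ℕ → (Fin N ⊕ Fin N) → ℂ) : Prop :=
  (∀ i < k, ∀ j < k, star (v i) ⬝ᵥ v j = if i = j then 1 else 0) ∧
  (∀ i < k, ∀ j < k, v i ⬝ᵥ Zmat N *ᵥ v j = 0) ∧
  (∀ j, j + 1 < k → ∃ c : ℕ → ℂ, (c (j + 1)).im = 0 ∧
    X *ᵥ v j = ∑ i ∈ Finset.range (j + 2), c i • v i)

lemma pvl_isoX {N : ℕ} (X : Matrix (Fin N ⊕ Fin N) (Fin N ⊕ Fin N) ℂ) (hX : dual X = X) (k : ℕ)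
    (v : ℕ → (Fin N ⊕ Fin N) → ℂ) (h : PvlBasis X k v) (i : ℕ) (hi : i < k) (j : ℕ) (hj : j < k) :
    v i ⬝ᵥ (Zmat N * X) *ᵥ v j = 0 := by
  obtain ⟨-, h2, h3⟩ := h
  have key : ∀ i < k, ∀ j, j + 1 < k → v i ⬝ᵥ (Zmat N * X) *ᵥ v j = 0 := by
    intro i hi j hj
    obtain ⟨c, -, hc⟩ := h3 j hj
    rw [← mulVec_mulVec, hc, mulVec_sum, dotProduct_sum]
    refine Finset.sum_eq_zero fun l hl => ?_
    have := Finset.mem_range.mp hl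
    rw [mulVec_smul, dotProduct_smul, h2 i hi l (by omega), smul_zero]
  by_cases hj1 : j + 1 < k
  · exact key i hi j hj1
  by_cases hi1 : i + 1 < k
  · rw [pvl_skew _ (pvl_ZXt X hX), key j hj i hi1, neg_zero]
  have : i = j := by omega
  subst this
  exact pvl_alt _ (pvl_ZXt X hX) _

lemma pvl_next {N : ℕ} (X : Matrix (Fin N ⊕ Fin N) (Fin N ⊕ Fin N) ℂ) (hX : dual X = X) (k : ℕ)
    (hk : k < N) (v : ℕ → (Fin N ⊕ Fin N) → ℂ) (h : PvlBasis X k v) :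
    ∃ u : (Fin N ⊕ Fin N) → ℂ, star u ⬝ᵥ u = 1 ∧ (∀ i < k, star (v i) ⬝ᵥ u = 0) ∧
      (∀ i < k, v i ⬝ᵥ Zmat N *ᵥ u = 0) ∧
      ∀ j, j + 1 = k → ∃ (c : ℕ → ℂ) (r : ℝ),
        X *ᵥ v j = ∑ i ∈ Finset.range k, c i • v i + (r : ℂ) • u := by
  have hiso := pvl_isoX X hX k v h
  obtain ⟨h1, h2, h3⟩ := h
  let c : ℕ → ℂ := fun i => star (v i) ⬝ᵥ X *ᵥ v (k - 1)
  let w := X *ᵥ v (k - 1) - ∑ i ∈ Finset.range k, c i • v i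
  have hXw : X *ᵥ v (k - 1) = ∑ i ∈ Finset.range k, c i • v i + w := by simp [w]
  by_cases hw : k ≠ 0 ∧ w ≠ 0
  · obtain ⟨hk0, hw⟩ := hw
    obtain ⟨r, s, u, hu1, hwu, huw⟩ := pvl_normalize w hw
    refine ⟨u, hu1, fun i hi => ?_, fun i hi => ?_, fun j hj => ⟨c, r, ?_⟩⟩
    · rw [huw, dotProduct_smul, dotProduct_sub, dotProduct_sum,
        Finset.sum_eq_single_of_mem i (Finset.mem_range.mpr hi)]
      · rw [dotProduct_smul, h1 i hi i hi]
        simp [c]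
      · intro l hl hli
        rw [dotProduct_smul, h1 i hi l (Finset.mem_range.mp hl), if_neg (Ne.symm hli), smul_zero]
    · rw [huw, mulVec_smul, dotProduct_smul, mulVec_sub, dotProduct_sub, mulVec_mulVec,
        hiso i hi (k - 1) (by omega), mulVec_sum, dotProduct_sum, Finset.sum_eq_zero]
      · simp
      · intro l hl
        rw [mulVec_smul, dotProduct_smul, h2 i hi l (Finset.mem_range.mp hl), smul_zero]
    · obtain rfl : j = k - 1 := by omega
      rw [← hwu, hXw]
  · obtain ⟨w', hw', ho, hz⟩ := pvl_exists hk v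
    obtain ⟨r, s, u, hu1, hwu, huw⟩ := pvl_normalize w' hw'
    refine ⟨u, hu1, fun i hi => ?_, fun i hi => ?_, fun j hj => ⟨c, 0, ?_⟩⟩
    · rw [huw, dotProduct_smul, ho i hi, smul_zero]
    · rw [huw, mulVec_smul, dotProduct_smul, hz i hi, smul_zero]
    · obtain rfl : j = k - 1 := by omega
      have hw0 : w = 0 := by
        by_contra hne
        exact hw ⟨by omega, hne⟩
      rw [hXw, hw0]
      simp

lemma pvl_basis {N : ℕ} (X : Matrix (Fin N ⊕ Fin N) (Fin N ⊕ Fin N) ℂ) (hX : dual X = X) (k : ℕ)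
    (hk : k ≤ N) : ∃ v, PvlBasis X k v := by
  induction k with
  | zero => exact ⟨fun _ => 0, by simp [PvlBasis]⟩
  | succ k ih =>
    obtain ⟨v, h⟩ := ih (by omega)
    obtain ⟨u, hu1, huo, huz, huX⟩ := pvl_next X hX k (by omega) v h
    obtain ⟨h1, h2, h3⟩ := h
    have hvk : Function.update v k u k = u := by simp
    have hvi : ∀ i < k, Function.update v k u i = v i := fun i hi => by
      rw [Function.update_of_ne (by omega)]
    refine ⟨Function.update v k u, fun i hi j hj => ?_, fun i hi j hj => ?_, fun j hj => ?_⟩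
    · rcases Nat.lt_succ_iff_lt_or_eq.mp hi with hi | rfl <;>
        rcases Nat.lt_succ_iff_lt_or_eq.mp hj with hj | rfl
      · rw [hvi i hi, hvi j hj, h1 i hi j hj]
      · rw [hvi i hi, hvk, huo i hi, if_neg (by omega)]
      · rw [hvi j hj, hvk, if_neg (by omega), star_dotProduct, huo j hj, star_zero]
      · rw [hvk, if_pos rfl, hu1]
    · rcases Nat.lt_succ_iff_lt_or_eq.mp hi with hi | rfl <;>
        rcases Nat.lt_succ_iff_lt_or_eq.mp hj with hj | rfl
      · rw [hvi i hi, hvi j hj, h2 i hi j hj]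
      · rw [hvi i hi, hvk, huz i hi]
      · rw [hvi j hj, hvk, pvl_skew _ (pvl_Zt N), huz j hj, neg_zero]
      · exact pvl_alt _ (pvl_Zt N) _
    · rw [hvi j (by omega)]
      by_cases hjk : j + 1 < k
      · obtain ⟨c, hc, hs⟩ := h3 j hjk
        refine ⟨c, hc, hs.trans (Finset.sum_congr rfl fun i hi => ?_)⟩
        have := Finset.mem_range.mp hi
        rw [hvi i (by omega)]
      · have hjk' : j + 1 = k := by omega
        obtain ⟨c, r, hs⟩ := huX j hjk'
        refine ⟨Function.update c k r, ?_, ?_⟩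
        · rw [hjk']; simp
        · rw [show j + 2 = k + 1 by omega, Finset.sum_range_succ, hvk, hs]
          congr 1
          · refine Finset.sum_congr rfl fun i hi => ?_
            have := Finset.mem_range.mp hi
            rw [hvi i this, Function.update_of_ne (by omega)]
          · simp

/-- Paige/van Loan form — every self-dual matrix `X ∈ M_{2N}(ℂ)` is carried
by a symplectic unitary conjugation to the block form `[[A, C],[0, Aᵀ]]` with `A` upper
Hessenberg having real subdiagonal entries. -/
theorem paige_van_loan (N : ℕ) (X : Matrix (Fin N ⊕ Fin N) (Fin N ⊕ Fin N) ℂ)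
    (hX : dual X = X) :
    ∃ (U : Matrix (Fin N ⊕ Fin N) (Fin N ⊕ Fin N) ℂ) (A C : Matrix (Fin N) (Fin N) ℂ),
      Uᴴ * U = 1 ∧ Uᵀ * Zmat N * U = Zmat N ∧
      Uᴴ * X * U = Matrix.fromBlocks A C 0 Aᵀ ∧
      (∀ i j : Fin N, (j : ℕ) + 1 < (i : ℕ) → A i j = 0) ∧
      (∀ i j : Fin N, (i : ℕ) = (j : ℕ) + 1 → (A i j).im = 0) := by
  obtain ⟨v, hb⟩ := pvl_basis X hX N le_rfl
  have hiso := pvl_isoX X hX N v hb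
  obtain ⟨h1, h2, h3⟩ := hb
  let V : Matrix (Fin N ⊕ Fin N) (Fin N) ℂ := Matrix.of fun r j => v j r
  have entryT : ∀ (M : Matrix (Fin N ⊕ Fin N) (Fin N ⊕ Fin N) ℂ) (i j : Fin N),
      (Vᵀ * (M * V)) i j = v i ⬝ᵥ M *ᵥ v j := fun M i j => rfl
  have entryH : ∀ (M : Matrix (Fin N ⊕ Fin N) (Fin N ⊕ Fin N) ℂ) (i j : Fin N),
      (Vᴴ * (M * V)) i j = star (v i) ⬝ᵥ M *ᵥ v j := fun M i j => rfl
  have hV1 : Vᴴ * V = 1 := by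
    ext i j
    have := h1 i i.2 j j.2
    rw [Matrix.one_apply]
    simp only [← Fin.ext_iff] at this
    exact this
  have hV2 : Vᵀ * (Zmat N * V) = 0 := by
    ext i j
    rw [entryT, h2 i i.2 j j.2]; rfl
  have hV3 : Vᵀ * ((Zmat N * X) * V) = 0 := by
    ext i j
    rw [entryT, hiso i i.2 j j.2]; rfl
  have hV1t : Vᵀ * Vᴴᵀ = 1 := by
    rw [← transpose_mul, hV1, transpose_one]
  have hV2h : Vᴴ * (Zmat N * Vᴴᵀ) = 0 := by
    have := congrArg (fun M => Mᴴᵀ) hV2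
    simp only [conjTranspose_mul, transpose_mul, pvl_Zh, transpose_neg, pvl_Zt, neg_neg] at this
    have hc : Vᵀᴴᵀ = Vᴴ := by ext; simp
    simpa [hc] using this
  let W : Matrix (Fin N ⊕ Fin N) (Fin N) ℂ := Zmat N * Vᴴᵀ
  have hWt : Wᵀ = -(Vᴴ * Zmat N) := by
    simp [W, transpose_mul, pvl_Zt]
  have hcc : Vᴴᵀᴴ = Vᵀ := by ext; simp
  have hWh : Wᴴ = -(Vᵀ * Zmat N) := by
    simp only [W, conjTranspose_mul, pvl_Zh, hcc, Matrix.mul_neg]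
  have hZW : Zmat N * W = -Vᴴᵀ := by
    simp [W, ← Matrix.mul_assoc, pvl_ZZ]
  refine ⟨fromCols V W, Vᴴ * (X * V), Vᴴ * (X * W), ?_, ?_, ?_, ?_, ?_⟩
  · rw [conjTranspose_fromCols_eq_fromRows_conjTranspose, fromRows_mul_fromCols,
      ← fromBlocks_one]
    congr 1
    · rw [hWh, Matrix.neg_mul, Matrix.mul_assoc, hV2, neg_zero]
    · rw [hWh, Matrix.neg_mul, Matrix.mul_assoc, hZW, Matrix.mul_neg, neg_neg, hV1t]
  · rw [transpose_fromCols, Matrix.mul_assoc, mul_fromCols, fromRows_mul_fromCols, hZW]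
    conv_rhs => rw [Zmat]
    congr 1
    · rw [Matrix.mul_neg, hV1t]
    · rw [hWt, Matrix.neg_mul, Matrix.mul_assoc, ← Matrix.mul_assoc (Zmat N), pvl_ZZ]
      simp [hV1]
    · rw [hWt, Matrix.mul_neg, Matrix.neg_mul, neg_neg, Matrix.mul_assoc, hV2h]
  · rw [conjTranspose_fromCols_eq_fromRows_conjTranspose, Matrix.mul_assoc, mul_fromCols,
      fromRows_mul_fromCols]
    congr 1
    · rw [hWh, Matrix.neg_mul, Matrix.mul_assoc, ← Matrix.mul_assoc (Zmat N), hV3, neg_zero]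
    · rw [hWh, Matrix.neg_mul, Matrix.mul_assoc, ← Matrix.mul_assoc (Zmat N), pvl_ZX X hX,
        Matrix.mul_assoc, hZW, transpose_mul, transpose_mul]
      simp [Matrix.mul_assoc]
  · intro i j hij
    have hi := i.2
    obtain ⟨c, -, hc⟩ := h3 j (by omega)
    rw [entryH, hc, dotProduct_sum]
    refine Finset.sum_eq_zero fun l hl => ?_
    have := Finset.mem_range.mp hl
    rw [dotProduct_smul, h1 i hi l (by omega), if_neg (by omega), smul_zero]
  · intro i j hij
    have hi := i.2
    obtain ⟨c, hr, hc⟩ := h3 j (by omega)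
    rw [entryH, hc, dotProduct_sum,
      Finset.sum_eq_single_of_mem (i : ℕ) (Finset.mem_range.mpr (by omega))]
    · rw [dotProduct_smul, h1 i hi i hi, if_pos rfl, hij]
      simpa using hr
    · intro l hl hli
      have := Finset.mem_range.mp hl
      rw [dotProduct_smul, h1 i hi l (by omega), if_neg (Ne.symm hli), smul_zero]
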